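/- Abstract iteration lemma used to conclude Dini mean oscillation: let φ : (0, 1] → [0, ∞) be bounded, let N₀ > 0, let μ ∈ (0, 1/2) be chosen so that N₀μ ≤ 1/2 (more generally N₀μ < 1), and let ω : (0, 2] → [0, ∞) be a Dini modulus (nondecreasing, ∫₀¹ ω(t)/t dt < ∞) such that φ(μr) ≤ N₀ μ φ(r) + ω(r) for all r ∈ (0, 1]. Then the function r ↦ φ(r) itself satisfies a Dini condition: there is a nondecreasing function ω̃ with ∫₀¹ ω̃(t)/t dt < ∞ and φ(r) ≤ ω̃(r) for all r ∈ (0, 1]; in particular φ(r) → 0 as r → 0. -/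

import Mathlib

open MeasureTheory Set Filter Topology

noncomputable section

/-- `ω` is a Dini modulus on `(0, 2]`: nonnegative, nondecreasing, and
`∫₀¹ ω(t)/t dt < ∞`. -/
def DiniModulusOn (ω : ℝ → ℝ) : Prop :=
  (∀ r ∈ Set.Ioc (0 : ℝ) 2, 0 ≤ ω r) ∧ MonotoneOn ω (Set.Ioc (0 : ℝ) 2) ∧
  IntegrableOn (fun t => ω t / t) (Set.Ioc (0 : ℝ) 1)

/-- If `f` is monotone on `(0, 1]`, then `f t / t` is integrable on every subinterval bounded away
from zero. -/
theorem MonotoneOn.intervalIntegrable_div_id {f : ℝ → ℝ} (hf : MonotoneOn f (Ioc 0 1))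
    {a b : ℝ} (ha : 0 < a) (hab : a ≤ b) (hb : b ≤ 1) :
    IntervalIntegrable (fun t => f t / t) volume a b := by
  simp only [div_eq_mul_inv]
  have hsub : uIcc a b ⊆ Ioc 0 1 := by
    rw [uIcc_of_le hab]
    exact fun x hx => ⟨ha.trans_le hx.1, hx.2.trans hb⟩
  exact (hf.mono hsub).intervalIntegrable.mul_continuousOn
    (continuousOn_inv₀.mono fun x hx => (hsub hx).1.ne')

/-- A nonnegative nondecreasing function satisfying the Dini condition tends to zero at zero. -/
theorem tendsto_zero_of_integrableOn_div_id {f : ℝ → ℝ} (hf0 : ∀ r ∈ Ioc (0 : ℝ) 1, 0 ≤ f r)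
    (hf : MonotoneOn f (Ioc 0 1)) (hint : IntegrableOn (fun t => f t / t) (Ioc 0 1)) :
    Tendsto f (𝓝[>] 0) (𝓝 0) := by
  have hmem : Ioc (0 : ℝ) 1 ∈ 𝓝[>] (0 : ℝ) := Ioc_mem_nhdsGT one_pos
  refine Metric.tendsto_nhds.2 fun ε hε => ?_
  obtain ⟨r, hr, hrε⟩ : ∃ r ∈ Ioc (0 : ℝ) 1, f r < ε := by
    by_contra! hle
    have hinv : IntegrableOn (fun t : ℝ => t⁻¹) (Ioc 0 1) := by
      refine (hint.const_mul ε⁻¹).mono' measurable_inv.aestronglyMeasurable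
        ((ae_restrict_iff' measurableSet_Ioc).2 (ae_of_all _ fun t ht => ?_))
      rw [Real.norm_of_nonneg (inv_nonneg.2 ht.1.le), inv_eq_one_div, ← mul_div_assoc]
      refine div_le_div_of_nonneg_right ?_ ht.1.le
      rw [inv_mul_eq_div, one_le_div hε]
      exact hle t ht
    have h := intervalIntegrable_inv_iff.1
      ((intervalIntegrable_iff_integrableOn_Ioc_of_le zero_le_one).2 hinv)
    simp at h
  filter_upwards [hmem, Ioc_mem_nhdsGT hr.1] with t ht htr
  rw [Real.dist_eq, sub_zero, abs_of_nonneg (hf0 t ht)]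
  exact (hf ht hr htr.2).trans_lt hrε

/-- A nonnegative nondecreasing function that contracts under a dilation, up to an error
satisfying the Dini condition, satisfies the Dini condition. -/
theorem integrableOn_div_id_of_contraction {f ω : ℝ → ℝ} {μ θ : ℝ}
    (hf0 : ∀ r ∈ Ioc (0 : ℝ) 1, 0 ≤ f r) (hf : MonotoneOn f (Ioc 0 1))
    (hω0 : ∀ r ∈ Ioc (0 : ℝ) 1, 0 ≤ ω r) (hω : IntegrableOn (fun t => ω t / t) (Ioc 0 1))
    (hμ0 : 0 < μ) (hμ1 : μ < 1) (hθ : θ < 1)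
    (hiter : ∀ r ∈ Ioc (0 : ℝ) 1, f (μ * r) ≤ θ * f r + ω r) :
    IntegrableOn (fun t => f t / t) (Ioc 0 1) := by
  have key : ∀ a ∈ Ioo (0 : ℝ) 1, ∫ t in a..1, f t / t ≤
      ((∫ t in Ioc 0 1, ω t / t) + ∫ t in μ..1, f t / t) / (1 - θ) := by
    intro a ha
    have hμa : 0 < μ * a := mul_pos hμ0 ha.1
    have hμa' : μ * a ≤ a := mul_le_of_le_one_left ha.1.le hμ1.le
    have hμaμ : μ * a ≤ μ := mul_le_of_le_one_right hμ0.le ha.2.le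
    have hωa : IntegrableOn (fun t => ω t / t) (Ioc a 1) :=
      hω.mono_set (Ioc_subset_Ioc_left ha.1.le)
    have hωi : IntervalIntegrable (fun t => ω t / t) volume a 1 :=
      (intervalIntegrable_iff_integrableOn_Ioc_of_le ha.2.le).2 hωa
    have hfi := hf.intervalIntegrable_div_id ha.1 ha.2.le le_rfl
    have hleft := hf.intervalIntegrable_div_id hμa hμa' ha.2.le
    have hmid := hf.intervalIntegrable_div_id hμa hμaμ hμ1.le
    have hright := hf.intervalIntegrable_div_id hμ0 hμ1.le le_rfl
    have hext : ∫ t in a..1, f t / t ≤ ∫ t in (μ * a)..1, f t / t := by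
      rw [← intervalIntegral.integral_add_adjacent_intervals hleft hfi]
      have : 0 ≤ ∫ t in (μ * a)..a, f t / t :=
        intervalIntegral.integral_nonneg hμa' fun t ht =>
          div_nonneg (hf0 t ⟨hμa.trans_le ht.1, ht.2.trans ha.2.le⟩) (hμa.le.trans ht.1)
      linarith
    have hscale : ∫ t in (μ * a)..μ, f t / t = ∫ t in a..1, f (μ * t) / t := by
      have h := intervalIntegral.mul_integral_comp_mul_left (a := a) (b := 1)
        (f := fun t => f t / t) (c := μ)
      rw [mul_one] at h
      rw [← h, ← intervalIntegral.integral_const_mul]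
      congr 1
      ext t
      rw [← mul_div_assoc, mul_div_mul_left _ _ hμ0.ne']
    have hdil : MonotoneOn (fun t => f (μ * t)) (Ioc 0 1) := by
      have hmaps : ∀ t ∈ Ioc (0 : ℝ) 1, μ * t ∈ Ioc (0 : ℝ) 1 := fun t ht =>
        ⟨mul_pos hμ0 ht.1, mul_le_one₀ hμ1.le ht.1.le ht.2⟩
      exact fun s hs t ht hst =>
        hf (hmaps s hs) (hmaps t ht) (mul_le_mul_of_nonneg_left hst hμ0.le)
    have hcontr : ∫ t in a..1, f (μ * t) / t ≤
        θ * (∫ t in a..1, f t / t) + ∫ t in a..1, ω t / t := by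
      rw [← intervalIntegral.integral_const_mul,
        ← intervalIntegral.integral_add (hfi.const_mul θ) hωi]
      refine intervalIntegral.integral_mono_on ha.2.le
        (hdil.intervalIntegrable_div_id ha.1 ha.2.le le_rfl) ((hfi.const_mul θ).add hωi)
        fun t ht => ?_
      have ht0 : 0 < t := ha.1.trans_le ht.1
      rw [← mul_div_assoc, ← add_div]
      exact div_le_div_of_nonneg_right (hiter t ⟨ht0, ht.2⟩) ht0.le
    have herr : ∫ t in a..1, ω t / t ≤ ∫ t in Ioc 0 1, ω t / t := by
      rw [intervalIntegral.integral_of_le ha.2.le]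
      refine setIntegral_mono_set hω ?_ (Ioc_subset_Ioc_left ha.1.le).eventuallyLE
      exact (ae_restrict_iff' measurableSet_Ioc).2
        (ae_of_all _ fun t ht => div_nonneg (hω0 t ht) ht.1.le)
    have hsplit := intervalIntegral.integral_add_adjacent_intervals hmid hright
    rw [le_div_iff₀ (sub_pos.2 hθ)]
    linarith
  obtain ⟨a, -, ha, hlim⟩ := exists_seq_strictAnti_tendsto' (zero_lt_one' ℝ)
  refine integrableOn_Ioc_of_intervalIntegral_norm_bounded_left
    (fun n => (hf.intervalIntegrable_div_id (ha n).1 (ha n).2.le le_rfl).1) hlim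
    (Eventually.of_forall fun n => le_of_eq_of_le ?_ (key (a n) (ha n)))
  rw [intervalIntegral.integral_of_le (ha n).2.le]
  refine setIntegral_congr_fun measurableSet_Ioc fun t ht => ?_
  have ht0 : 0 < t := (ha n).1.trans ht.1
  exact Real.norm_of_nonneg (div_nonneg (hf0 t ⟨ht0, ht.2⟩) ht0.le)

/-- Abstract iteration lemma: if `φ : (0,1] → [0,∞)` is bounded, `N₀ > 0`, `μ ∈ (0,1/2)`
with `N₀μ < 1`, `ω` is a Dini modulus on `(0,2]`, and `φ(μr) ≤ N₀μ φ(r) + ω(r)` for all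
`r ∈ (0,1]`, then `φ` itself satisfies a Dini condition: there is a nondecreasing `ω̃`
with `∫₀¹ ω̃(t)/t dt < ∞` and `φ(r) ≤ ω̃(r)` on `(0,1]`; in particular `φ(r) → 0` as
`r → 0⁺`. -/
theorem dini_iteration_lemma
    (φ : ℝ → ℝ) (hφ0 : ∀ r ∈ Set.Ioc (0 : ℝ) 1, 0 ≤ φ r)
    (hφbdd : ∃ B, ∀ r ∈ Set.Ioc (0 : ℝ) 1, φ r ≤ B)
    (N₀ : ℝ) (hN₀ : 0 < N₀) (μ : ℝ) (hμ : μ ∈ Set.Ioo (0 : ℝ) (1 / 2))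
    (hcontr : N₀ * μ < 1)
    (ω : ℝ → ℝ) (hω : DiniModulusOn ω)
    (hiter : ∀ r ∈ Set.Ioc (0 : ℝ) 1, φ (μ * r) ≤ N₀ * μ * φ r + ω r) :
    (∃ ω' : ℝ → ℝ, (∀ r ∈ Set.Ioc (0 : ℝ) 1, 0 ≤ ω' r) ∧
      MonotoneOn ω' (Set.Ioc (0 : ℝ) 1) ∧
      IntegrableOn (fun t => ω' t / t) (Set.Ioc (0 : ℝ) 1) ∧
      ∀ r ∈ Set.Ioc (0 : ℝ) 1, φ r ≤ ω' r) ∧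
    Tendsto φ (𝓝[>] (0 : ℝ)) (𝓝 0) := by
  obtain ⟨B, hB⟩ := hφbdd
  obtain ⟨hω0, hωmono, hωint⟩ := hω
  have hbdd : ∀ r ∈ Ioc (0 : ℝ) 1, BddAbove (φ '' Ioc 0 r) := by
    rintro r hr
    refine ⟨B, ?_⟩
    rintro _ ⟨s, hs, rfl⟩
    exact hB s ⟨hs.1, hs.2.trans hr.2⟩
  have hne : ∀ r ∈ Ioc (0 : ℝ) 1, (φ '' Ioc 0 r).Nonempty := fun r hr =>
    (nonempty_Ioc.2 hr.1).image φ
  set Φ : ℝ → ℝ := fun r => sSup (φ '' Ioc 0 r) with hΦ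
  have hle : ∀ r ∈ Ioc (0 : ℝ) 1, ∀ s ∈ Ioc 0 r, φ s ≤ Φ r := fun r hr s hs =>
    le_csSup (hbdd r hr) (mem_image_of_mem φ hs)
  have hφΦ : ∀ r ∈ Ioc (0 : ℝ) 1, φ r ≤ Φ r := fun r hr => hle r hr r ⟨hr.1, le_rfl⟩
  have hΦ0 : ∀ r ∈ Ioc (0 : ℝ) 1, 0 ≤ Φ r := fun r hr => (hφ0 r hr).trans (hφΦ r hr)
  have hΦmono : MonotoneOn Φ (Ioc 0 1) := fun r hr s hs hrs =>
    csSup_le_csSup (hbdd s hs) (hne r hr) (image_mono (Ioc_subset_Ioc_right hrs))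
  have hsub : Ioc (0 : ℝ) 1 ⊆ Ioc 0 2 := Ioc_subset_Ioc_right one_le_two
  have hμ1 : μ < 1 := hμ.2.trans one_half_lt_one
  have hΦiter : ∀ r ∈ Ioc (0 : ℝ) 1, Φ (μ * r) ≤ N₀ * μ * Φ r + ω r := by
    intro r hr
    refine csSup_le
      (hne _ ⟨mul_pos hμ.1 hr.1, mul_le_one₀ hμ1.le hr.1.le hr.2⟩) ?_
    rintro _ ⟨s, hs, rfl⟩
    have hsr : s / μ ∈ Ioc 0 r := ⟨div_pos hs.1 hμ.1, (div_le_iff₀' hμ.1).2 hs.2⟩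
    have hs1 : s / μ ∈ Ioc (0 : ℝ) 1 := ⟨hsr.1, hsr.2.trans hr.2⟩
    calc φ s = φ (μ * (s / μ)) := by rw [mul_div_cancel₀ _ hμ.1.ne']
      _ ≤ N₀ * μ * φ (s / μ) + ω (s / μ) := hiter _ hs1
      _ ≤ N₀ * μ * Φ r + ω r :=
        add_le_add (mul_le_mul_of_nonneg_left (hle r hr _ hsr) (mul_pos hN₀ hμ.1).le)
          (hωmono (hsub hs1) (hsub hr) hsr.2)
  have hΦint : IntegrableOn (fun t => Φ t / t) (Ioc 0 1) :=
    integrableOn_div_id_of_contraction hΦ0 hΦmono (fun r hr => hω0 r (hsub hr)) hωint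
      hμ.1 hμ1 hcontr hΦiter
  have hmem : Ioc (0 : ℝ) 1 ∈ 𝓝[>] (0 : ℝ) := Ioc_mem_nhdsGT one_pos
  exact ⟨⟨Φ, hΦ0, hΦmono, hΦint, hφΦ⟩,
    tendsto_of_tendsto_of_tendsto_of_le_of_le' tendsto_const_nhds
      (tendsto_zero_of_integrableOn_div_id hΦ0 hΦmono hΦint)
      (mem_of_superset hmem hφ0) (mem_of_superset hmem hφΦ)⟩

end
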